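/- arXiv:math-ph/0303020 — 5 statements merged into one kernel-verified Lean document; each statement's English description precedes it below -/
import Mathlib

section
/- Let t ∈ ℝ and let φ, g : ℝ → ℂ be Schwartz functions. Then the limit as λ → 0⁺ of the double integral ∫_ℝ ∫_ℝ λ⁻² exp(i(t'−t)E/λ²) φ(t') g(E) dE dt' exists and equals 2π φ(t) g(0). (This is the precise meaning of the distributional limit λ⁻² e^{i(t'−t)E/λ²} → 2π δ(t'−t) δ(E) used in the stochastic limit.) -/
open MeasureTheory Filter Complex

open FourierTransform in
lemma inner_eq_aux (g : SchwartzMap ℝ ℂ) (c u : ℝ) (hc : c ≠ 0) (z : ℂ) (t : ℝ) :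
    (∫ E : ℝ, ((c : ℝ) : ℂ)⁻¹ *
      Complex.exp (Complex.I * (((t + 2 * Real.pi * c * u : ℝ) : ℂ) - (t : ℂ)) * (E : ℂ) / (c : ℂ)) *
        z * g E) = (c : ℂ)⁻¹ * z * (𝓕⁻ g) u := by
  have hcc : (c : ℂ) ≠ 0 := by exact_mod_cast hc
  rw [SchwartzMap.fourierInv_coe, Real.fourierInv_eq', ← integral_const_mul]
  congr 1
  ext E
  have : Complex.I * (((t + 2 * Real.pi * c * u : ℝ) : ℂ) - (t : ℂ)) * (E : ℂ) / (c : ℂ)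
      = ((2 * Real.pi * inner ℝ E u : ℝ) : ℂ) * Complex.I := by
    simp
    field_simp
  rw [this, smul_eq_mul]
  ring

open FourierTransform in
lemma subst_aux (t : ℝ) (φ g : SchwartzMap ℝ ℂ) (c : ℝ) (hc : 0 < c) :
    (∫ t' : ℝ, ∫ E : ℝ, ((c : ℝ) : ℂ)⁻¹ *
      Complex.exp (Complex.I * ((t' : ℂ) - (t : ℂ)) * (E : ℂ) / (c : ℂ)) *
        φ t' * g E) =
    2 * Real.pi * ∫ u : ℝ, φ (t + 2 * Real.pi * c * u) * (𝓕⁻ g) u := by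
  set F : ℝ → ℂ := fun t' => ∫ E : ℝ, ((c : ℝ) : ℂ)⁻¹ *
      Complex.exp (Complex.I * ((t' : ℂ) - (t : ℂ)) * (E : ℂ) / (c : ℂ)) *
        φ t' * g E with hF
  have hpos : 0 < 2 * Real.pi * c := by positivity
  have h1 := integral_add_left_eq_self (μ := volume) F t
  have h2 := Measure.integral_comp_mul_left (fun x => F (t + x)) (2 * Real.pi * c)
  rw [h1, abs_of_pos (inv_pos.mpr hpos)] at h2
  have h3 : ∀ u, F (t + 2 * Real.pi * c * u)
      = (c : ℂ)⁻¹ * (φ (t + 2 * Real.pi * c * u) * (𝓕⁻ g) u) := by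
    intro u
    have := inner_eq_aux g c u hc.ne' (φ (t + 2 * Real.pi * c * u)) t
    rw [hF]
    simp only
    rw [this]
    ring
  simp_rw [h3] at h2
  rw [integral_const_mul] at h2
  have hcc : (c : ℂ) ≠ 0 := by exact_mod_cast hc.ne'
  have hpi : (Real.pi : ℂ) ≠ 0 := by exact_mod_cast Real.pi_ne_zero
  rw [Complex.real_smul] at h2
  push_cast at h2
  field_simp at h2
  rw [← h2]
  ring

open FourierTransform in
lemma lim_aux (t : ℝ) (φ g : SchwartzMap ℝ ℂ) :
    Tendsto (fun lam : ℝ => ∫ u : ℝ, φ (t + 2 * Real.pi * lam ^ 2 * u) * (𝓕⁻ g) u)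
      (nhdsWithin 0 (Set.Ioi 0)) (nhds (φ t * g 0)) := by
  have h0 : (∫ u : ℝ, φ t * (𝓕⁻ g) u) = φ t * g 0 := by
    rw [integral_const_mul]
    congr 1
    have h : 𝓕 (𝓕⁻ g) = g := FourierTransform.fourier_fourierInv_eq g
    conv_rhs => rw [← h]
    rw [SchwartzMap.fourier_coe, Real.fourier_eq']
    simp
  rw [← h0]
  obtain ⟨C, hC⟩ : ∃ C, ∀ x, ‖φ x‖ ≤ C :=
    ⟨_, fun x => SchwartzMap.norm_le_seminorm ℝ φ x⟩
  refine tendsto_integral_filter_of_dominated_convergence (fun u => C * ‖(𝓕⁻ g) u‖) ?_ ?_ ?_ ?_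
  · refine Eventually.of_forall fun lam => Continuous.aestronglyMeasurable ?_
    have := φ.continuous
    have := (𝓕⁻ g).continuous
    fun_prop
  · refine Eventually.of_forall fun lam => Eventually.of_forall fun u => ?_
    rw [norm_mul]
    gcongr
    exact hC _
  · exact ((𝓕⁻ g).integrable.norm).const_mul C
  · refine Eventually.of_forall fun u => Tendsto.mono_left ?_ nhdsWithin_le_nhds
    have hc : Continuous fun lam : ℝ => φ (t + 2 * Real.pi * lam ^ 2 * u) * (𝓕⁻ g) u := by
      have := φ.continuous
      fun_prop
    simpa using hc.tendsto 0


/-- For `t ∈ ℝ` and Schwartz functions `φ, g : ℝ → ℂ`, the double integral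
`∫_ℝ ∫_ℝ λ⁻² exp(i(t'−t)E/λ²) φ(t') g(E) dE dt'` converges, as `λ → 0⁺`, to
`2π φ(t) g(0)`. -/
theorem limit_delta_delta (t : ℝ) (φ g : SchwartzMap ℝ ℂ) :
    Tendsto
      (fun lam : ℝ =>
        ∫ t' : ℝ, ∫ E : ℝ,
          ((lam ^ 2 : ℝ) : ℂ)⁻¹ *
            Complex.exp (Complex.I * ((t' : ℂ) - (t : ℂ)) * (E : ℂ) / ((lam ^ 2 : ℝ) : ℂ)) *
            φ t' * g E)
      (nhdsWithin 0 (Set.Ioi 0))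
      (nhds (2 * (Real.pi : ℂ) * φ t * g 0)) := by
  have h := (lim_aux t φ g).const_mul (2 * (Real.pi : ℂ))
  rw [← mul_assoc] at h
  refine h.congr' ?_
  filter_upwards [self_mem_nhdsWithin] with lam hlam
  have hl : 0 < lam := hlam
  exact (subst_aux t φ g (lam ^ 2) (by positivity)).symm
end

section
/- Let g : ℝ → ℂ be a Schwartz function and E₀ ∈ ℝ. Then: (1) the principal value P.V.∫ g(E)/(E−E₀) dE := lim_{δ→0⁺} ∫_{{E : |E−E₀| ≥ δ}} g(E)/(E−E₀) dE exists; (2) the limit lim_{ε→0⁺} ∫_ℝ g(E)/(i(E−E₀−iε)) dE exists and equals π g(E₀) − i · P.V.∫ g(E)/(E−E₀) dE. (This Sokhotski–Plemelj-type limit gives meaning to the kernels 1/(i(E'−E−i0)) appearing in the functions γ_{g,f}(E) of the low density limit.) -/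
open MeasureTheory Filter Complex

lemma sp_h_integrable (f : ℝ → ℂ) (hf : Integrable f) (C : ℝ)
    (hL : ∀ x, ‖f x - f (-x)‖ ≤ C * |x|) :
    Integrable (fun x : ℝ => (‖f x - f (-x)‖ * |x|⁻¹ : ℝ)) := by
  have hd : Integrable (fun x => f x - f (-x)) := hf.sub hf.comp_neg
  have hind : Integrable ((Set.Icc (-1:ℝ) 1).indicator (fun _ => C)) :=
    (integrable_indicator_iff measurableSet_Icc).2
      (continuous_const.integrableOn_Icc)
  refine (hd.norm.add hind).mono' ?_ ?_
  · exact hd.norm.aestronglyMeasurable.mul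
      (measurable_id.abs.inv).aestronglyMeasurable
  · refine Eventually.of_forall fun x => ?_
    have hC : 0 ≤ C := by
      have := (norm_nonneg _).trans (hL 1)
      simpa using this
    simp only [Pi.add_apply, norm_mul, norm_norm, norm_inv, Real.norm_eq_abs, abs_abs, abs_norm]
    by_cases hx : x ∈ Set.Icc (-1:ℝ) 1
    · rw [Set.indicator_of_mem hx]
      have h1 : ‖f x - f (-x)‖ * |x|⁻¹ ≤ C := by
        rcases eq_or_ne x 0 with rfl | h0
        · simpa using hC
        · rw [← div_eq_mul_inv, div_le_iff₀ (abs_pos.2 h0)]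
          exact hL x
      linarith [norm_nonneg (f x - f (-x))]
    · rw [Set.indicator_of_notMem hx, add_zero]
      have h1 : 1 ≤ |x| := by
        by_contra h
        exact hx (abs_le.1 (not_le.1 h).le)
      exact mul_le_of_le_one_right (norm_nonneg _) (inv_le_one_of_one_le₀ h1)

lemma sp_kernel (f : ℝ → ℂ) (hf : Integrable f) (C : ℝ)
    (hL : ∀ x, ‖f x - f (-x)‖ ≤ C * |x|) (K : ℝ → ℝ → ℝ)
    (hm : ∀ d, Measurable (K d))
    (hodd : ∀ d x, K d (-x) = - K d x)
    (hK : ∀ d x, |K d x| ≤ |x|⁻¹)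
    (hB : ∀ d, 0 < d → ∃ B, ∀ x, |K d x| ≤ B)
    (hlim : ∀ x, x ≠ 0 → Tendsto (fun d => K d x) (nhdsWithin 0 (Set.Ioi 0)) (nhds x⁻¹)) :
    Tendsto (fun d => ∫ x, f x * (K d x : ℂ)) (nhdsWithin 0 (Set.Ioi 0))
      (nhds (∫ x : ℝ, (f x - f (-x)) * ((x⁻¹ : ℝ) : ℂ) / 2)) := by
  have key : ∀ d, 0 < d → ∫ x, (f x - f (-x)) * (K d x : ℂ) / 2 = ∫ x, f x * (K d x : ℂ) := by
    intro d hd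
    obtain ⟨B, hB⟩ := hB d hd
    have hi : Integrable (fun x => f x * (K d x : ℂ)) :=
      hf.mul_bdd (c := B) (measurable_ofReal.comp (hm d)).aestronglyMeasurable
        (Eventually.of_forall fun x => by simpa using hB x)
    have h2 : ∫ x, f (-x) * (K d (-x) : ℂ) = ∫ x, f x * (K d x : ℂ) :=
      integral_neg_eq_self (fun x => f x * (K d x : ℂ)) volume
    have h3 : ∀ x, (f x - f (-x)) * (K d x : ℂ) / 2
        = (f x * (K d x : ℂ) + f (-x) * (K d (-x) : ℂ)) / 2 := by
      intro x; rw [hodd]; push_cast; ring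
    simp_rw [h3]
    rw [integral_div, integral_add hi hi.comp_neg, h2]
    ring
  have hd : Integrable (fun x => f x - f (-x)) := hf.sub hf.comp_neg
  refine Tendsto.congr' (f₁ := fun d => ∫ x, (f x - f (-x)) * (K d x : ℂ) / 2) ?_ ?_
  · filter_upwards [self_mem_nhdsWithin] with d hd using key d hd
  · refine tendsto_integral_filter_of_dominated_convergence
      (fun x : ℝ => (‖f x - f (-x)‖ * |x|⁻¹ : ℝ)) ?_ ?_ (sp_h_integrable f hf C hL) ?_
    · refine Eventually.of_forall fun d => ?_
      simp_rw [div_eq_mul_inv]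
      exact (hd.aestronglyMeasurable.mul
        (measurable_ofReal.comp (hm d)).aestronglyMeasurable).mul_const _
    · refine Eventually.of_forall fun d => Eventually.of_forall fun x => ?_
      have h1 := mul_le_mul_of_nonneg_left (hK d x) (norm_nonneg (f x - f (-x)))
      have h2 : 0 ≤ ‖f x - f (-x)‖ * |K d x| := by positivity
      simp only [norm_div, norm_mul, Complex.norm_real, Real.norm_eq_abs, Complex.norm_ofNat]
      linarith
    · filter_upwards [Measure.ae_ne volume (0:ℝ)] with x hx
      exact (((continuous_ofReal.tendsto _).comp (hlim x hx)).const_mul _).div_const 2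

lemma sp_poisson (f : ℝ → ℂ) (hc : Continuous f) (M : ℝ) (hM : ∀ x, ‖f x‖ ≤ M) :
    Tendsto (fun d : ℝ => ∫ x, f x * ((d / (x ^ 2 + d ^ 2) : ℝ) : ℂ)) (nhdsWithin 0 (Set.Ioi 0))
      (nhds (Real.pi * f 0)) := by
  have hpi : ∫ t : ℝ, f 0 * (((1 + t ^ 2)⁻¹ : ℝ) : ℂ) = Real.pi * f 0 := by
    rw [integral_const_mul, integral_complex_ofReal, integral_univ_inv_one_add_sq, mul_comm]
  rw [← hpi]
  refine Tendsto.congr' (f₁ := fun d => ∫ t : ℝ, f (d * t) * (((1 + t ^ 2)⁻¹ : ℝ) : ℂ)) ?_ ?_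
  · filter_upwards [self_mem_nhdsWithin] with d hd
    have hd : 0 < d := hd
    have h := Measure.integral_comp_mul_left (fun x => f x * ((d / (x ^ 2 + d ^ 2) : ℝ) : ℂ)) d
    rw [abs_of_pos (inv_pos.2 hd)] at h
    have h2 : ∀ t : ℝ, f (d * t) * (((1 + t ^ 2)⁻¹ : ℝ) : ℂ)
        = d • (f (d * t) * ((d / ((d * t) ^ 2 + d ^ 2) : ℝ) : ℂ)) := by
      intro t
      have : (1 + t ^ 2)⁻¹ = d * (d / ((d * t) ^ 2 + d ^ 2)) := by
        have : 0 < 1 + t ^ 2 := by positivity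
        have : 0 < (d * t) ^ 2 + d ^ 2 := by positivity
        field_simp
        ring
      rw [this, Complex.real_smul]
      push_cast
      ring
    simp_rw [h2]
    rw [integral_smul, h, smul_smul, mul_inv_cancel₀ hd.ne', one_smul]
  · refine tendsto_integral_filter_of_dominated_convergence
      (fun t : ℝ => M * (1 + t ^ 2)⁻¹) ?_ ?_ (integrable_inv_one_add_sq.const_mul M) ?_
    · refine Eventually.of_forall fun d => ?_
      refine Continuous.aestronglyMeasurable ?_
      refine (hc.comp (by fun_prop)).mul (continuous_ofReal.comp ?_)
      exact Continuous.inv₀ (by fun_prop) (fun t => by positivity)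
    · refine Eventually.of_forall fun d => Eventually.of_forall fun t => ?_
      have : 0 ≤ (1 + t ^ 2)⁻¹ := by positivity
      rw [norm_mul, Complex.norm_real, Real.norm_of_nonneg this]
      exact mul_le_mul_of_nonneg_right (hM _) this
    · refine Eventually.of_forall fun t => ?_
      refine Tendsto.mul_const _ ?_
      have : Continuous (fun d : ℝ => f (d * t)) := hc.comp (by fun_prop)
      have := this.tendsto 0
      simp only [zero_mul] at this
      exact this.mono_left nhdsWithin_le_nhds

lemma sp_main (f : ℝ → ℂ) (hf : Integrable f) (hc : Continuous f) (M : ℝ) (hM : ∀ x, ‖f x‖ ≤ M)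
    (C : ℝ) (hL : ∀ x, ‖f x - f (-x)‖ ≤ C * |x|) :
    ∃ P : ℂ,
      Tendsto (fun δ : ℝ => ∫ x in {x : ℝ | δ ≤ |x|}, f x / (x : ℂ))
        (nhdsWithin 0 (Set.Ioi 0)) (nhds P) ∧
      Tendsto (fun ε : ℝ => ∫ x : ℝ, f x / (Complex.I * ((x : ℂ) - Complex.I * (ε : ℂ))))
        (nhdsWithin 0 (Set.Ioi 0)) (nhds ((Real.pi : ℂ) * f 0 - Complex.I * P)) := by
  refine ⟨∫ x : ℝ, (f x - f (-x)) * ((x⁻¹ : ℝ) : ℂ) / 2, ?_, ?_⟩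
  · have hS : ∀ d : ℝ, MeasurableSet {x : ℝ | d ≤ |x|} := fun d =>
      measurableSet_le measurable_const measurable_id.abs
    have := sp_kernel f hf C hL (fun d => {x : ℝ | d ≤ |x|}.indicator (fun x => x⁻¹))
      (fun d => measurable_inv.indicator (hS d)) ?_ ?_ ?_ ?_
    · refine this.congr fun d => ?_
      rw [← integral_indicator (hS d)]
      congr 1
      ext x
      by_cases hx : d ≤ |x| <;> simp [Set.indicator, hx, div_eq_mul_inv]
    · intro d x
      by_cases hx : d ≤ |x| <;> simp [Set.indicator, hx, inv_neg]
    · intro d x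
      by_cases hx : d ≤ |x| <;> simp [Set.indicator, hx, abs_inv]
    · intro d hd
      refine ⟨d⁻¹, fun x => ?_⟩
      by_cases hx : d ≤ |x|
      · simpa [Set.indicator, hx, abs_inv] using inv_anti₀ hd hx
      · simp [Set.indicator, hx, hd.le]
    · intro x hx
      refine tendsto_const_nhds.congr' ?_
      filter_upwards [nhdsWithin_le_nhds (Iio_mem_nhds (abs_pos.2 hx))] with d hd
      have : d ≤ |x| := le_of_lt hd
      simp [Set.indicator, this]
  · have hB2 : ∀ d : ℝ, 0 < d → ∀ x : ℝ, |x / (x ^ 2 + d ^ 2)| ≤ d⁻¹ := by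
      intro d hd x
      have : 0 < x ^ 2 + d ^ 2 := by positivity
      rw [abs_div, abs_of_pos this, div_le_iff₀ this, inv_mul_eq_div, le_div_iff₀ hd]
      nlinarith [sq_nonneg (|x| - d), sq_abs x, sq_nonneg x, sq_nonneg d]
    have h1 := sp_kernel f hf C hL (fun d x => x / (x ^ 2 + d ^ 2))
      (fun d => by fun_prop) (fun d x => by rw [neg_sq, neg_div]) ?_
      (fun d hd => ⟨d⁻¹, hB2 d hd⟩) ?_
    · have h2 := (sp_poisson f hc M hM).sub (h1.const_mul Complex.I)
      refine h2.congr' ?_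
      filter_upwards [self_mem_nhdsWithin] with d hd
      have hd : 0 < d := hd
      have i1 : Integrable (fun x => f x * ((x / (x ^ 2 + d ^ 2) : ℝ) : ℂ)) :=
        hf.mul_bdd (c := d⁻¹) (Measurable.aestronglyMeasurable (by fun_prop))
          (Eventually.of_forall fun x => by
            rw [Complex.norm_real]; exact hB2 d hd x)
      have i2 : Integrable (fun x => f x * ((d / (x ^ 2 + d ^ 2) : ℝ) : ℂ)) :=
        hf.mul_bdd (c := d⁻¹) (Measurable.aestronglyMeasurable (by fun_prop))
          (Eventually.of_forall fun x => by
            have : 0 < x ^ 2 + d ^ 2 := by positivity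
            rw [Complex.norm_real, Real.norm_of_nonneg (by positivity), div_le_iff₀ this,
              inv_mul_eq_div, le_div_iff₀ hd]
            nlinarith [sq_nonneg x])
      rw [← integral_const_mul, ← integral_sub i2 (i1.const_mul _)]
      congr 1
      ext x
      have hp : 0 < x ^ 2 + d ^ 2 := by positivity
      have hp' : (x:ℂ) ^ 2 + (d:ℂ) ^ 2 ≠ 0 := by exact_mod_cast hp.ne'
      have hfac : ((x:ℂ) - I * d) * (x + I * d) = (x:ℂ) ^ 2 + (d:ℂ) ^ 2 := by
        linear_combination (-(d:ℂ) ^ 2) * I_sq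
      have hz : (x:ℂ) - I * d ≠ 0 := fun h => hp' (by rw [← hfac, h, zero_mul])
      push_cast
      rw [eq_div_iff (mul_ne_zero I_ne_zero hz)]
      field_simp
      linear_combination f x * hfac - f x * (x * (x - I * d)) * I_sq - f x * ((x:ℂ) - I * d) * x
    · intro d x
      rcases eq_or_ne x 0 with rfl | h0
      · simp
      · have : 0 < x ^ 2 := by positivity
        have h3 : 0 < x ^ 2 + d ^ 2 := by positivity
        have h4 : 0 < |x| := abs_pos.2 h0
        rw [abs_div, abs_of_pos h3, div_le_iff₀ h3, inv_mul_eq_div, le_div_iff₀ h4]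
        nlinarith [sq_abs x, sq_nonneg d]
    · intro x hx
      have : ContinuousAt (fun d : ℝ => x / (x ^ 2 + d ^ 2)) 0 :=
        ContinuousAt.div (by fun_prop) (by fun_prop) (by simpa using hx)
      have := this.tendsto
      have e : x / (x ^ 2 + 0 ^ 2) = x⁻¹ := by field_simp; ring
      rw [e] at this
      exact this.mono_left nhdsWithin_le_nhds



/-- Sokhotski–Plemelj-type limit. For a Schwartz function `g : ℝ → ℂ` and
`E₀ ∈ ℝ`, the principal value `P.V.∫ g(E)/(E−E₀) dE` exists (as the limit `δ → 0⁺` of the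
integrals over `{E : |E−E₀| ≥ δ}`), and
`lim_{ε→0⁺} ∫ g(E)/(i(E−E₀−iε)) dE = π g(E₀) − i · P.V.∫ g(E)/(E−E₀) dE`. -/
theorem sokhotski_plemelj (g : SchwartzMap ℝ ℂ) (E₀ : ℝ) :
    ∃ P : ℂ,
      Tendsto
        (fun δ : ℝ => ∫ E in {E : ℝ | δ ≤ |E - E₀|}, g E / ((E : ℂ) - (E₀ : ℂ)))
        (nhdsWithin 0 (Set.Ioi 0)) (nhds P) ∧
      Tendsto
        (fun ε : ℝ =>
          ∫ E : ℝ, g E / (Complex.I * ((E : ℂ) - (E₀ : ℂ) - Complex.I * (ε : ℂ))))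
        (nhdsWithin 0 (Set.Ioi 0))
        (nhds ((Real.pi : ℂ) * g E₀ - Complex.I * P)) := by
  obtain ⟨M, hM⟩ : ∃ M, ∀ x, ‖g x‖ ≤ M := by
    obtain ⟨M, hM⟩ := g.decay 0 0
    exact ⟨M, fun x => by simpa using hM.2 x⟩
  obtain ⟨C, hC⟩ : ∃ C, ∀ x, ‖deriv g x‖ ≤ C := by
    obtain ⟨C, hC⟩ := g.decay 0 1
    exact ⟨C, fun x => by
      have := hC.2 x
      rw [norm_iteratedFDeriv_eq_norm_iteratedDeriv, iteratedDeriv_one] at this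
      simpa using this⟩
  have hLip : ∀ x y, ‖g y - g x‖ ≤ C * ‖y - x‖ := fun x y =>
    Convex.norm_image_sub_le_of_norm_deriv_le (fun x _ => g.differentiableAt)
      (fun x _ => hC x) convex_univ (Set.mem_univ x) (Set.mem_univ y)
  obtain ⟨P, h1, h2⟩ := sp_main (fun x => g (x + E₀)) (g.integrable.comp_add_right E₀)
    (g.continuous.comp (by fun_prop)) M (fun x => hM _) (2 * C) (fun x => by
      refine (hLip _ _).trans (le_of_eq ?_)
      have : x + E₀ - (-x + E₀) = 2 * x := by ring
      rw [this, Real.norm_eq_abs, abs_mul, abs_two]; ring)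
  refine ⟨P, h1.congr fun d => ?_, ?_⟩
  · have hS : MeasurableSet {x : ℝ | d ≤ |x|} :=
      measurableSet_le measurable_const measurable_id.abs
    have hS' : MeasurableSet {x : ℝ | d ≤ |x - E₀|} :=
      measurableSet_le measurable_const (by fun_prop)
    rw [← integral_indicator hS, ← integral_indicator hS',
      ← integral_add_right_eq_self (μ := volume)
        ({x : ℝ | d ≤ |x - E₀|}.indicator fun E : ℝ => g E / ((E : ℂ) - (E₀ : ℂ))) E₀]
    congr 1
    ext x
    by_cases hx : d ≤ |x| <;> simp [Set.indicator, hx]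
  · simp only [zero_add] at h2
    refine h2.congr fun d => ?_
    rw [← integral_add_right_eq_self (μ := volume)
      (fun E : ℝ => g E / (Complex.I * ((E : ℂ) - (E₀ : ℂ) - Complex.I * (d : ℂ)))) E₀]
    congr 1
    ext x
    push_cast
    rw [add_sub_cancel_right]
end

section
/- Let t > 0, let f : [0,∞) → ℂ be bounded, measurable, and left-continuous at every point of (0,∞), and let g : ℝ → ℂ be a Schwartz function. Then lim_{λ→0⁺} ∫₀ᵗ ∫_ℝ λ⁻² exp(i(t'−t)E/λ²) f(t') g(E) dE dt' = f(t) · lim_{ε→0⁺} ∫_ℝ g(E)/(i(E−iε)) dE, where the inner limit on the right-hand side exists. (This is the precise meaning of the causal distributional limit λ⁻² e^{i(t'−t)E/λ²} → δ₊(t'−t) · 1/(i(E−i0)) on the simplex t ≥ t' ≥ 0.) -/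
open MeasureTheory Filter Complex

/-- the oscillatory integral of `g` -/
noncomputable def oscH (g : SchwartzMap ℝ ℂ) (u : ℝ) : ℂ :=
  ∫ E : ℝ, Complex.exp (-(Complex.I * u * E)) * g E

lemma oscH_eq (g : SchwartzMap ℝ ℂ) (u : ℝ) :
    oscH g u = (FourierTransform.fourier g : SchwartzMap ℝ ℂ) (u / (2 * Real.pi)) := by
  rw [SchwartzMap.fourier_coe, Real.fourier_real_eq_integral_exp_smul]
  unfold oscH
  congr 1
  ext E
  rw [smul_eq_mul]
  congr 2
  have : (Real.pi : ℂ) ≠ 0 := by exact_mod_cast Real.pi_ne_zero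
  push_cast
  field_simp

lemma oscH_integrable (g : SchwartzMap ℝ ℂ) : Integrable (oscH g) := by
  have h := (FourierTransform.fourier g : SchwartzMap ℝ ℂ).integrable (μ := volume)
  have h2 := h.comp_div (R := 2 * Real.pi) (by positivity)
  exact h2.congr (Eventually.of_forall fun u => (oscH_eq g u).symm)

lemma oscH_continuous (g : SchwartzMap ℝ ℂ) : Continuous (oscH g) := by
  have : oscH g = fun u => (FourierTransform.fourier g : SchwartzMap ℝ ℂ) (u / (2 * Real.pi)) :=
    funext (oscH_eq g)
  rw [this]
  exact (FourierTransform.fourier g : SchwartzMap ℝ ℂ).continuous.comp (by fun_prop)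

lemma resolvent_eq (g : SchwartzMap ℝ ℂ) (ε : ℝ) (hε : 0 < ε) :
    ∫ E : ℝ, g E / (Complex.I * ((E : ℂ) - Complex.I * (ε : ℂ)))
      = ∫ u in Set.Ioi (0 : ℝ), Complex.exp (-(ε * u : ℂ)) * oscH g u := by
  have key : ∀ E : ℝ, g E / (Complex.I * ((E : ℂ) - Complex.I * (ε : ℂ)))
      = ∫ u in Set.Ioi (0 : ℝ),
          Complex.exp (-(ε * u : ℂ)) * (Complex.exp (-(Complex.I * u * E)) * g E) := by
    intro E
    have h1 : ∀ u : ℝ, Complex.exp (-(ε * u : ℂ)) * (Complex.exp (-(Complex.I * u * E)) * g E)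
        = Complex.exp ((-(ε + Complex.I * E) : ℂ) * u) * g E := by
      intro u
      rw [← mul_assoc, ← Complex.exp_add]
      congr 2
      ring
    simp_rw [h1]
    rw [integral_mul_const, integral_exp_mul_complex_Ioi (by simpa using hε)]
    have h2 : Complex.I * ((E : ℂ) - Complex.I * (ε : ℂ)) = ε + Complex.I * E := by
      linear_combination (-(ε : ℂ)) * Complex.I_mul_I
    rw [h2]
    rw [Complex.ofReal_zero, mul_zero, Complex.exp_zero, neg_div_neg_eq, div_mul_eq_mul_div, one_mul]
  simp_rw [key]
  rw [integral_integral_swap]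
  · congr 1
    ext u
    rw [integral_const_mul]
    rfl
  · have hi : Integrable (fun u : ℝ => Complex.exp (-(ε * u : ℂ)))
        (volume.restrict (Set.Ioi 0)) := by
      have := integrableOn_exp_mul_complex_Ioi (a := (-ε : ℂ)) (by simpa using hε) 0
      refine this.congr (Eventually.of_forall fun u => ?_)
      simp
    have hp := (g.integrable (μ := volume)).mul_prod hi
    refine hp.mono ?_ (Eventually.of_forall ?_)
    · apply Continuous.aestronglyMeasurable
      have := g.continuous
      unfold Function.uncurry
      fun_prop
    · rintro ⟨E, u⟩
      simp [Function.uncurry, Complex.norm_exp]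
      rw [mul_comm]

lemma inner_eq (g : SchwartzMap ℝ ℂ) (t s : ℝ) (lam : ℝ) (z : ℂ) :
    ∫ E : ℝ, ((lam ^ 2 : ℝ) : ℂ)⁻¹ *
        Complex.exp (Complex.I * ((s : ℂ) - (t : ℂ)) * (E : ℂ) / ((lam ^ 2 : ℝ) : ℂ)) * z * g E
      = ((lam ^ 2 : ℝ) : ℂ)⁻¹ * (z * oscH g ((t - s) / lam ^ 2)) := by
  unfold oscH
  rw [← integral_const_mul, ← integral_const_mul]
  congr 1
  ext E
  have : Complex.I * ((s : ℂ) - (t : ℂ)) * (E : ℂ) / ((lam ^ 2 : ℝ) : ℂ)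
      = -(Complex.I * (((t - s) / lam ^ 2 : ℝ) : ℂ) * E) := by
    push_cast
    ring
  rw [this]
  ring

lemma outer_eq (g : SchwartzMap ℝ ℂ) (f : ℝ → ℂ) (t lam : ℝ) (hl : 0 < lam) :
    ∫ s in Set.Icc (0 : ℝ) t, ((lam ^ 2 : ℝ) : ℂ)⁻¹ * (f s * oscH g ((t - s) / lam ^ 2))
      = ∫ u in Set.Ici (0 : ℝ),
          (Set.Ici (0 : ℝ)).indicator f (t - lam ^ 2 * u) * oscH g u := by
  have hl2 : 0 < lam ^ 2 := by positivity
  rw [integral_const_mul, ← integral_indicator measurableSet_Icc,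
    ← integral_indicator measurableSet_Ici, ← integral_sub_left_eq_self _ volume t]
  have := Measure.integral_comp_mul_left (fun x => (Set.Icc (0 : ℝ) t).indicator
    (fun s => f s * oscH g ((t - s) / lam ^ 2)) (t - x)) (lam ^ 2)
  rw [abs_of_pos (inv_pos.mpr hl2), Complex.real_smul, Complex.ofReal_inv] at this
  rw [← this]
  congr 1
  ext u
  by_cases hu : 0 ≤ u
  · have h0 : 0 ≤ lam ^ 2 * u := by positivity
    by_cases h1 : 0 ≤ t - lam ^ 2 * u
    · rw [Set.indicator_of_mem (by constructor <;> linarith),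
        Set.indicator_of_mem (by exact hu), Set.indicator_of_mem (by exact h1)]
      congr 2
      field_simp
      ring
    · rw [Set.indicator_of_notMem (fun h => h1 h.1),
        Set.indicator_of_mem (by exact hu), Set.indicator_of_notMem (by exact h1), zero_mul]
  · have h0 : lam ^ 2 * u < 0 := mul_neg_of_pos_of_neg hl2 (not_le.mp hu)
    rw [Set.indicator_of_notMem (fun h => by linarith [h.2]),
        Set.indicator_of_notMem (by exact hu)]

/-- the causal distributional limit
`λ⁻² e^{i(t'−t)E/λ²} → δ₊(t'−t)·1/(i(E−i0))` on the simplex `t ≥ t' ≥ 0`.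
For `t > 0`, `f : [0,∞) → ℂ` bounded, measurable and left-continuous on `(0,∞)`,
and `g` a Schwartz function,
`lim_{λ→0⁺} ∫₀ᵗ ∫_ℝ λ⁻² exp(i(t'−t)E/λ²) f(t') g(E) dE dt'
  = f(t) · lim_{ε→0⁺} ∫_ℝ g(E)/(i(E−iε)) dE`, the inner limit existing. -/
theorem causal_delta_limit (t : ℝ) (ht : 0 < t) (f : ℝ → ℂ)
    (hf_bdd : ∃ M : ℝ, ∀ s : ℝ, 0 ≤ s → ‖f s‖ ≤ M)
    (hf_meas : Measurable f)
    (hf_lc : ∀ s : ℝ, 0 < s → Tendsto f (nhdsWithin s (Set.Iio s)) (nhds (f s)))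
    (g : SchwartzMap ℝ ℂ) :
    ∃ c : ℂ,
      Tendsto
        (fun ε : ℝ => ∫ E : ℝ, g E / (Complex.I * ((E : ℂ) - Complex.I * (ε : ℂ))))
        (nhdsWithin 0 (Set.Ioi 0)) (nhds c) ∧
      Tendsto
        (fun lam : ℝ =>
          ∫ t' in Set.Icc (0 : ℝ) t, ∫ E : ℝ,
            ((lam ^ 2 : ℝ) : ℂ)⁻¹ *
              Complex.exp (Complex.I * ((t' : ℂ) - (t : ℂ)) * (E : ℂ) / ((lam ^ 2 : ℝ) : ℂ)) *
              f t' * g E)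
        (nhdsWithin 0 (Set.Ioi 0)) (nhds (f t * c)) := by
  obtain ⟨M, hM⟩ := hf_bdd
  have hH := oscH_integrable g
  have hHc := oscH_continuous g
  refine ⟨∫ u in Set.Ioi (0 : ℝ), oscH g u, ?_, ?_⟩
  · have : Tendsto (fun ε : ℝ => ∫ u in Set.Ioi (0 : ℝ), Complex.exp (-(ε * u : ℂ)) * oscH g u)
        (nhdsWithin 0 (Set.Ioi 0)) (nhds (∫ u in Set.Ioi (0 : ℝ), oscH g u)) := by
      refine tendsto_integral_filter_of_dominated_convergence (fun u => ‖oscH g u‖) ?_ ?_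
        hH.norm.integrableOn ?_
      · refine Eventually.of_forall fun ε => Continuous.aestronglyMeasurable ?_
        fun_prop
      · filter_upwards [self_mem_nhdsWithin] with ε hε
        filter_upwards [ae_restrict_mem measurableSet_Ioi] with u hu
        rw [norm_mul, Complex.norm_exp]
        have h0 : 0 ≤ ε * u := (mul_pos hε hu).le
        have h1 : Real.exp ((-(ε * u : ℂ)).re) ≤ 1 := by
          rw [Real.exp_le_one_iff]
          simpa using h0
        exact mul_le_of_le_one_left (norm_nonneg _) h1
      · refine Eventually.of_forall fun u => ?_
        have hc : Continuous (fun ε : ℝ => Complex.exp (-(ε * u : ℂ)) * oscH g u) := by fun_prop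
        have := (hc.tendsto 0).mono_left (nhdsWithin_le_nhds (s := Set.Ioi 0))
        simpa using this
    refine this.congr' ?_
    filter_upwards [self_mem_nhdsWithin] with ε hε
    exact (resolvent_eq g ε hε).symm
  · rw [← integral_const_mul, ← integral_Ici_eq_integral_Ioi]
    have : Tendsto (fun lam : ℝ => ∫ u in Set.Ici (0 : ℝ),
          (Set.Ici (0 : ℝ)).indicator f (t - lam ^ 2 * u) * oscH g u)
        (nhdsWithin 0 (Set.Ioi 0)) (nhds (∫ u in Set.Ici (0 : ℝ), f t * oscH g u)) := by
      refine tendsto_integral_filter_of_dominated_convergence (fun u => M * ‖oscH g u‖) ?_ ?_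
        (hH.norm.const_mul M).integrableOn ?_
      · refine Eventually.of_forall fun lam => ?_
        have h1 : Measurable ((Set.Ici (0 : ℝ)).indicator f) := hf_meas.indicator measurableSet_Ici
        have h2 := hHc.measurable
        exact Measurable.aestronglyMeasurable (by fun_prop)
      · refine Eventually.of_forall fun lam => Eventually.of_forall fun u => ?_
        rw [norm_mul]
        refine mul_le_mul_of_nonneg_right ?_ (norm_nonneg _)
        by_cases h : t - lam ^ 2 * u ∈ Set.Ici (0 : ℝ)
        · rw [Set.indicator_of_mem h]
          exact hM _ h
        · rw [Set.indicator_of_notMem h, norm_zero]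
          exact (norm_nonneg _).trans (hM 0 le_rfl)
      · rw [← restrict_Ioi_eq_restrict_Ici]
        filter_upwards [ae_restrict_mem measurableSet_Ioi] with u hu
        refine Tendsto.mul_const _ ?_
        have hc : Continuous (fun lam : ℝ => t - lam ^ 2 * u) := by fun_prop
        have h1 : Tendsto (fun lam : ℝ => t - lam ^ 2 * u) (nhdsWithin 0 (Set.Ioi 0)) (nhds t) := by
          have := (hc.tendsto 0).mono_left (nhdsWithin_le_nhds (s := Set.Ioi 0))
          simpa using this
        have h2 : Tendsto (fun lam : ℝ => t - lam ^ 2 * u) (nhdsWithin 0 (Set.Ioi 0))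
            (nhdsWithin t (Set.Iio t)) := by
          refine tendsto_nhdsWithin_iff.mpr ⟨h1, ?_⟩
          filter_upwards [self_mem_nhdsWithin] with lam hl
          have : 0 < lam ^ 2 * u := mul_pos (pow_pos hl 2) hu
          simpa using this
        refine ((hf_lc t ht).comp h2).congr' ?_
        filter_upwards [h1.eventually (lt_mem_nhds ht)] with lam hl
        rw [Set.indicator_of_mem (by exact hl.le)]
        rfl
    refine this.congr' ?_
    filter_upwards [self_mem_nhdsWithin] with lam hl
    rw [← outer_eq g f t lam hl]
    simp_rw [inner_eq]
end

section
/- Let n ≥ 2, t > 0, and let G : [0,∞)^{n−1} → ℂ be Lebesgue integrable. Then lim_{ξ→0⁺} ξ^{−(n−1)} ∫_{Δ} G((t₁−t₂)/ξ, (t₂−t₃)/ξ, …, (t_{n−1}−tₙ)/ξ) dt₁ ⋯ dtₙ = t · ∫_{[0,∞)^{n−1}} G(s₂,…,sₙ) ds₂ ⋯ dsₙ, where Δ = {(t₁,…,tₙ) : 0 ≤ tₙ ≤ t_{n−1} ≤ ⋯ ≤ t₁ ≤ t} is the standard simplex. (This simplex scaling limit produces the factor t and the chain of causal δ-functions δ₊(t₂−t₁)⋯δ₊(tₙ−t_{n−1})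 in the surviving connected diagram of the low density limit.) -/
open MeasureTheory Filter

noncomputable def T (k : ℕ) (ξ : ℝ) : (Fin (k+2) → ℝ) →ₗ[ℝ] (Fin (k+2) → ℝ) where
  toFun u := Fin.snoc (α := fun _ => ℝ) (fun i : Fin (k+1) => (u i.castSucc - u i.succ) / ξ) (u (Fin.last (k+1)))
  map_add' u v := by
    ext i
    refine Fin.lastCases ?_ (fun i => ?_) i
    · simp
    · simp; ring
  map_smul' c v := by
    ext i
    refine Fin.lastCases ?_ (fun i => ?_) i
    · simp
    · simp; ring

lemma T_det (k : ℕ) (ξ : ℝ) : LinearMap.det (T k ξ) = (ξ^(k+1))⁻¹ := by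
  rw [← LinearMap.det_toMatrix', Matrix.det_of_isUpperTriangular]
  · rw [Fin.prod_univ_castSucc]
    simp [LinearMap.toMatrix'_apply, T, Pi.single_apply, Fin.ext_iff]
  · intro i j hij
    revert hij
    refine Fin.lastCases ?_ (fun i => ?_) i
    · intro hij
      simp at hij
      simp [LinearMap.toMatrix'_apply, T, Pi.single_apply, hij.ne']
    · intro hij
      simp at hij
      have h1 : i.castSucc ≠ j := hij.ne'
      have h2 : i.succ ≠ j := (hij.trans i.castSucc_lt_succ).ne'
      simp [LinearMap.toMatrix'_apply, T, Pi.single_apply, h1, h2]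

lemma tele (k : ℕ) (u : Fin (k+2) → ℝ) : ∑ i : Fin (k+1), (u i.castSucc - u i.succ) = u 0 - u (Fin.last (k+1)) := by
  have h1 := Fin.sum_univ_succ u
  have h2 := Fin.sum_univ_castSucc u
  rw [Finset.sum_sub_distrib]; linarith

lemma T_emb (k : ℕ) (ξ : ℝ) (hξ : 0 < ξ) : MeasurableEmbedding (T k ξ) := by
  have hd : LinearMap.det (T k ξ) ≠ 0 := by rw [T_det]; positivity
  have hi : Function.Injective (T k ξ) := (LinearMap.equivOfDetNeZero (T k ξ) hd).injective
  exact (T k ξ).continuous_of_finiteDimensional.measurableEmbedding hi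

/-- The transformed domain. -/
def Aset (k : ℕ) (t ξ : ℝ) : Set (ℝ × (Fin (k+1) → ℝ)) :=
  {p | 0 ≤ p.1 ∧ p.1 ≤ t - ξ * ∑ i, p.2 i ∧ ∀ i, 0 ≤ p.2 i}

lemma Aset_meas (k : ℕ) (t ξ : ℝ) : MeasurableSet (Aset k t ξ) := by
  apply IsClosed.measurableSet
  simp only [Aset, Set.ofPred_and, Set.ofPred_forall]
  refine IsClosed.inter ?_ (IsClosed.inter ?_ (isClosed_iInter fun i => ?_))
  all_goals exact isClosed_le (by fun_prop) (by fun_prop)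

lemma P_meas (k : ℕ) : MeasurableSet {s : Fin (k + 1) → ℝ | ∀ i, 0 ≤ s i} := by
  apply IsClosed.measurableSet
  simp only [Set.ofPred_forall]
  exact isClosed_iInter fun i => isClosed_le (by fun_prop) (by fun_prop)

lemma D_meas (k : ℕ) (t : ℝ) : MeasurableSet {u : Fin (k + 2) → ℝ |
              u 0 ≤ t ∧ 0 ≤ u (Fin.last (k + 1)) ∧
              ∀ i : Fin (k + 1), u i.succ ≤ u i.castSucc} := by
  apply IsClosed.measurableSet
  simp only [Set.ofPred_and, Set.ofPred_forall]
  refine IsClosed.inter ?_ (IsClosed.inter ?_ (isClosed_iInter fun i => ?_))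
  all_goals exact isClosed_le (by fun_prop) (by fun_prop)

lemma A_int (k : ℕ) (t ξ : ℝ) (hξ : 0 < ξ) (G : (Fin (k + 1) → ℝ) → ℂ)
    (hG : IntegrableOn G {s : Fin (k + 1) → ℝ | ∀ i, 0 ≤ s i}) :
    Integrable ((Aset k t ξ).indicator (fun p => G p.2)) (volume.prod volume) := by
  have h1 : Integrable ((Set.Icc 0 t).indicator (fun _ => (1:ℂ))) :=
    (integrable_indicator_iff measurableSet_Icc).2 (integrableOn_const (by simp) (by simp))
  have h2 := (integrable_indicator_iff (P_meas k)).2 hG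
  have h3 := (h1.mul_prod h2).indicator (Aset_meas k t ξ)
  refine h3.congr (Eventually.of_forall fun p => ?_)
  by_cases hp : p ∈ Aset k t ξ
  · have hs : 0 ≤ ∑ i, p.2 i := Finset.sum_nonneg fun i _ => hp.2.2 i
    have h4 : p.1 ∈ Set.Icc 0 t := ⟨hp.1, hp.2.1.trans (by nlinarith)⟩
    have h5 : p.2 ∈ {s : Fin (k + 1) → ℝ | ∀ i, 0 ≤ s i} := hp.2.2
    simp only [Set.indicator_of_mem hp, Set.indicator_of_mem h4, Set.indicator_of_mem h5, one_mul]
  · simp only [Set.indicator_of_notMem hp]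

lemma main_eq (k : ℕ) (t ξ : ℝ) (hξ : 0 < ξ) (G : (Fin (k + 1) → ℝ) → ℂ)
    (hG : IntegrableOn G {s : Fin (k + 1) → ℝ | ∀ i, 0 ≤ s i}) :
    ((ξ : ℂ) ^ (k + 1))⁻¹ *
          ∫ u in {u : Fin (k + 2) → ℝ |
              u 0 ≤ t ∧ 0 ≤ u (Fin.last (k + 1)) ∧
              ∀ i : Fin (k + 1), u i.succ ≤ u i.castSucc},
            G (fun i : Fin (k + 1) => (u i.castSucc - u i.succ) / ξ)
    = ∫ s in {s : Fin (k + 1) → ℝ | ∀ i, 0 ≤ s i}, ((max 0 (t - ξ * ∑ i, s i) : ℝ) : ℂ) * G s := by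
  have hd : LinearMap.det (T k ξ) ≠ 0 := by rw [T_det]; positivity
  set F := (Aset k t ξ).indicator (fun p => G p.2) with hF
  let e := MeasurableEquiv.piFinSuccAbove (fun _ : Fin (k+2) => ℝ) (Fin.last (k+1))
  have he : MeasurePreserving e volume volume :=
    volume_preserving_piFinSuccAbove (fun _ : Fin (k+2) => ℝ) (Fin.last (k+1))
  have heT : ∀ u, e (T k ξ u) =
      (u (Fin.last (k+1)), fun i : Fin (k + 1) => (u i.castSucc - u i.succ) / ξ) := by
    intro u
    refine Prod.ext ?_ ?_
    · simp [e, T, MeasurableEquiv.piFinSuccAbove]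
    · ext i
      simp [e, T, MeasurableEquiv.piFinSuccAbove, Fin.removeNth]
  rw [← integral_indicator (D_meas k t)]
  have h1 : ∀ u, Set.indicator {u : Fin (k + 2) → ℝ |
              u 0 ≤ t ∧ 0 ≤ u (Fin.last (k + 1)) ∧
              ∀ i : Fin (k + 1), u i.succ ≤ u i.castSucc}
            (fun u => G (fun i : Fin (k + 1) => (u i.castSucc - u i.succ) / ξ)) u
          = F (e (T k ξ u)) := by
    intro u
    have hiff : u ∈ {u : Fin (k + 2) → ℝ |
              u 0 ≤ t ∧ 0 ≤ u (Fin.last (k + 1)) ∧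
              ∀ i : Fin (k + 1), u i.succ ≤ u i.castSucc} ↔ e (T k ξ u) ∈ Aset k t ξ := by
      rw [heT]
      have hs : ξ * ∑ i : Fin (k+1), (u i.castSucc - u i.succ) / ξ
          = u 0 - u (Fin.last (k+1)) := by
        rw [← Finset.sum_div, tele]; field_simp
      simp only [Aset, Set.mem_ofPred_eq, hs]
      have h3 : ∀ i : Fin (k+1), 0 ≤ (u i.castSucc - u i.succ) / ξ ↔ u i.succ ≤ u i.castSucc := by
        intro i
        rw [le_div_iff₀ hξ, zero_mul, sub_nonneg]
      simp only [h3]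
      constructor
      · rintro ⟨a, b, c⟩; exact ⟨b, by linarith, c⟩
      · rintro ⟨a, b, c⟩; exact ⟨by linarith, a, c⟩
    rw [hF]
    by_cases hu : e (T k ξ u) ∈ Aset k t ξ
    · rw [Set.indicator_of_mem hu, Set.indicator_of_mem (hiff.2 hu), heT]
    · rw [Set.indicator_of_notMem hu, Set.indicator_of_notMem (fun h => hu (hiff.1 h))]
  simp_rw [h1]
  rw [← (T_emb k ξ hξ).integral_map (fun v => F (e v)),
    Real.map_linearMap_volume_pi_eq_smul_volume_pi hd, integral_smul_measure,
    he.integral_comp e.measurableEmbedding]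
  have h2 : ENNReal.toReal (ENNReal.ofReal |(LinearMap.det (T k ξ))⁻¹|) = ξ^(k+1) := by
    rw [T_det, ENNReal.toReal_ofReal (abs_nonneg _), inv_inv, abs_of_pos (by positivity)]
  rw [h2, Complex.real_smul, Complex.ofReal_pow, inv_mul_cancel_left₀ (by
    have : (ξ:ℂ) ≠ 0 := by exact_mod_cast hξ.ne'
    positivity)]
  have h6 : ∫ y, F y = ∫ s, ∫ x, F (x, s) :=
    integral_prod_symm F (A_int k t ξ hξ G hG)
  rw [h6, ← integral_indicator (P_meas k)]
  congr 1
  ext s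
  by_cases hs : s ∈ {s : Fin (k + 1) → ℝ | ∀ i, 0 ≤ s i}
  · rw [Set.indicator_of_mem hs]
    have : ∀ x, F (x, s) = (Set.Icc 0 (t - ξ * ∑ i, s i)).indicator (fun _ => G s) x := by
      intro x
      by_cases hx : x ∈ Set.Icc 0 (t - ξ * ∑ i, s i)
      · have : (x, s) ∈ Aset k t ξ := ⟨hx.1, hx.2, hs⟩
        rw [Set.indicator_of_mem hx, hF, Set.indicator_of_mem this]
      · have : (x, s) ∉ Aset k t ξ := fun h => hx ⟨h.1, h.2.1⟩
        rw [Set.indicator_of_notMem hx, hF, Set.indicator_of_notMem this]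
    simp_rw [this]
    rw [integral_indicator measurableSet_Icc, setIntegral_const, Complex.real_smul]
    congr 2
    simp [Measure.real, ENNReal.toReal_ofReal', max_comm]
  · rw [Set.indicator_of_notMem hs]
    have : ∀ x, F (x, s) = 0 := fun x => Set.indicator_of_notMem (fun h => hs h.2.2) _
    simp [this]

/-- simplex scaling limit. For `n = k + 2 ≥ 2`, `t > 0` and an integrable
`G : [0,∞)^{n−1} → ℂ`,
`lim_{ξ→0⁺} ξ^{−(n−1)} ∫_Δ G((t₁−t₂)/ξ, …, (t_{n−1}−tₙ)/ξ) dt₁⋯dtₙ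
  = t · ∫_{[0,∞)^{n−1}} G(s₂,…,sₙ) ds₂⋯dsₙ`,
where `Δ = {0 ≤ tₙ ≤ ⋯ ≤ t₁ ≤ t}`. -/
theorem simplex_scaling_limit (k : ℕ) (t : ℝ) (ht : 0 < t)
    (G : (Fin (k + 1) → ℝ) → ℂ)
    (hG : IntegrableOn G {s : Fin (k + 1) → ℝ | ∀ i, 0 ≤ s i}) :
    Tendsto
      (fun ξ : ℝ =>
        ((ξ : ℂ) ^ (k + 1))⁻¹ *
          ∫ u in {u : Fin (k + 2) → ℝ |
              u 0 ≤ t ∧ 0 ≤ u (Fin.last (k + 1)) ∧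
              ∀ i : Fin (k + 1), u i.succ ≤ u i.castSucc},
            G (fun i : Fin (k + 1) => (u i.castSucc - u i.succ) / ξ))
      (nhdsWithin 0 (Set.Ioi 0))
      (nhds ((t : ℂ) * ∫ s in {s : Fin (k + 1) → ℝ | ∀ i, 0 ≤ s i}, G s)) := by
  rw [← integral_const_mul]
  refine Tendsto.congr' (f₁ := fun ξ : ℝ => ∫ s in {s : Fin (k + 1) → ℝ | ∀ i, 0 ≤ s i},
    ((max 0 (t - ξ * ∑ i, s i) : ℝ) : ℂ) * G s) ?_ ?_
  · filter_upwards [self_mem_nhdsWithin] with ξ hξ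
    exact (main_eq k t ξ hξ G hG).symm
  · refine tendsto_integral_filter_of_dominated_convergence (fun s => t * ‖G s‖) ?_ ?_ ?_ ?_
    · refine Eventually.of_forall fun ξ => ?_
      refine AEStronglyMeasurable.mul (Continuous.aestronglyMeasurable (by fun_prop)) hG.1
    · filter_upwards [self_mem_nhdsWithin] with ξ hξ
      filter_upwards [ae_restrict_mem (P_meas k)] with s hs
      have hs' : 0 ≤ ∑ i, s i := Finset.sum_nonneg fun i _ => hs i
      have hξ' : 0 < ξ := hξ
      rw [norm_mul, Complex.norm_real, Real.norm_of_nonneg (le_max_left _ _)]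
      refine mul_le_mul_of_nonneg_right (max_le ht.le ?_) (norm_nonneg _)
      have := mul_nonneg hξ'.le hs'
      linarith
    · exact hG.norm.const_mul t
    · refine Eventually.of_forall fun s => ?_
      have hc : Continuous fun ξ : ℝ => ((max 0 (t - ξ * ∑ i, s i) : ℝ) : ℂ) * G s := by fun_prop
      have := (hc.tendsto 0).mono_left (nhdsWithin_le_nhds (s := Set.Ioi 0))
      simpa [max_eq_right ht.le] using this
end

section
/- Let A be an associative unital algebra over ℂ, let γ₀₀, γ₀₁, γ₁₀, γ₁₁ ∈ ℂ, and let D, D', X, Y, a, b ∈ A satisfy (1 + γ₀₁ D') X = γ₀₀ D Y + a and (1 − γ₁₀ D) Y = −γ₁₁ D' X + b. Assume moreover that the elements T₀⁻¹ := 1 + γ₀₁ D' − γ₁₀ D + (γ₀₀γ₁₁ − γ₁₀γ₀₁) D D' and T₁⁻¹ := 1 + γ₀₁ D' − γ₁₀ D + (γ₀₀γ₁₁ − γ₁₀γ₀₁) D' D are invertible in A, with inverses T₀ and T₁ respectively. Then X = γ₀₀ T₀ D b + T₀ (1 − γ₁₀ D) a and Y = −γ₁₁ T₁ D' a + T₁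 (1 + γ₀₁ D') b. (This is the content of the normal-ordering lemma: it expresses B_{g₀}(E,t)U_t and B_{g₁}(E,t)U_t with all annihilators to the right of the evolution operator.) -/
/-- the normal-ordering lemma. Under the hypotheses of the elimination
identities and assuming that
`T₀⁻¹ = 1 + γ₀₁ D' − γ₁₀ D + (γ₀₀γ₁₁ − γ₁₀γ₀₁) D D'` and
`T₁⁻¹ = 1 + γ₀₁ D' − γ₁₀ D + (γ₀₀γ₁₁ − γ₁₀γ₀₁) D' D` are invertible with inverses
`T₀`, `T₁`, one has `X = γ₀₀ T₀ D b + T₀ (1 − γ₁₀ D) a` and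
`Y = −γ₁₁ T₁ D' a + T₁ (1 + γ₀₁ D') b`. -/
theorem normal_ordering_lemma {A : Type*} [Ring A] [Algebra ℂ A]
    (γ₀₀ γ₀₁ γ₁₀ γ₁₁ : ℂ) (D D' X Y a b T₀ T₁ : A)
    (h1 : (1 + γ₀₁ • D') * X = γ₀₀ • (D * Y) + a)
    (h2 : (1 - γ₁₀ • D) * Y = -(γ₁₁ • (D' * X)) + b)
    (hT₀l : T₀ * (1 + γ₀₁ • D' - γ₁₀ • D + (γ₀₀ * γ₁₁ - γ₁₀ * γ₀₁) • (D * D')) = 1)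
    (hT₀r : (1 + γ₀₁ • D' - γ₁₀ • D + (γ₀₀ * γ₁₁ - γ₁₀ * γ₀₁) • (D * D')) * T₀ = 1)
    (hT₁l : T₁ * (1 + γ₀₁ • D' - γ₁₀ • D + (γ₀₀ * γ₁₁ - γ₁₀ * γ₀₁) • (D' * D)) = 1)
    (hT₁r : (1 + γ₀₁ • D' - γ₁₀ • D + (γ₀₀ * γ₁₁ - γ₁₀ * γ₀₁) • (D' * D)) * T₁ = 1) :
    X = γ₀₀ • (T₀ * (D * b)) + T₀ * ((1 - γ₁₀ • D) * a) ∧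
      Y = -(γ₁₁ • (T₁ * (D' * a))) + T₁ * ((1 + γ₀₁ • D') * b) := by
  have ha : a = (1 + γ₀₁ • D') * X - γ₀₀ • (D * Y) := by rw [h1]; abel
  have hb : b = (1 - γ₁₀ • D) * Y + γ₁₁ • (D' * X) := by rw [h2]; abel
  have k0 : γ₀₀ • (D * b) + (1 - γ₁₀ • D) * a =
      (1 + γ₀₁ • D' - γ₁₀ • D + (γ₀₀ * γ₁₁ - γ₁₀ * γ₀₁) • (D * D')) * X := by
    rw [ha, hb]
    simp only [mul_add, add_mul, mul_sub, sub_mul, one_mul, smul_mul_assoc, mul_smul_comm,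
      mul_assoc]
    module
  have k1 : -(γ₁₁ • (D' * a)) + (1 + γ₀₁ • D') * b =
      (1 + γ₀₁ • D' - γ₁₀ • D + (γ₀₀ * γ₁₁ - γ₁₀ * γ₀₁) • (D' * D)) * Y := by
    rw [ha, hb]
    simp only [mul_add, add_mul, mul_sub, sub_mul, one_mul, smul_mul_assoc, mul_smul_comm,
      mul_assoc]
    module
  constructor
  · rw [← mul_smul_comm, ← mul_add, k0, ← mul_assoc, hT₀l, one_mul]
  · rw [← mul_smul_comm, ← mul_neg, ← mul_add, k1, ← mul_assoc, hT₁l, one_mul]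
end
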